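/- Let (Δ,Θ) be a directive bi-sequence with associated prefixes (w_n) and let n ≥ 1. Suppose the prefix of length n of (Δ,Θ) is normalized, Assumption A holds for (w_n, w_{n+1}), and exactly one pseudopalindromic prefix is missed between w_n and w_{n+1}. If w_n = w_{n−1}·c₁c₂·ϑ(w_{n−1}) for two distinct letters c₁, c₂ ∈ {0,1,2} and some ϑ ∈ {R,E_0,E_1,E_2} (equivalently, |w_n| = 2|w_{n−1}| + 2 with the two middle letters of w_n distinct), then there exist two distinct letters d₁, d₂ ∈ {0,1,2} and ϑ' ∈ {R,E_0,E_1,E_2} such that w_{n+1} = w_n·d₁d₂·ϑ'(w_n). -/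

import Mathlib

/-- The ternary alphabet. -/
abbrev Letter := Fin 3

/-- Finite words over the ternary alphabet. -/
abbrev Word := List Letter

/-- The four involutory antimorphisms of ternary words: the reversal `R`
and, for each letter `i`, the antimorphism `E i`. -/
inductive AM where
  | R : AM
  | E : Letter → AM
deriving DecidableEq

/-- The action of an antimorphism on a single letter: `R` fixes every letter,
and `E i` fixes `i` and exchanges the other two letters (in `Fin 3`,
this involution is `a ↦ -(i + a)`). -/
def AM.letter : AM → Letter → Letter
  | .R, _a => _a
  | .E i, a => -(i + a)

/-- The action of an antimorphism on a word: letterwise image followed by reversal. -/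
def AM.apply (t : AM) (w : Word) : Word := (w.map t.letter).reverse

/-- A word is a pseudopalindrome if it is a `ϑ`-palindrome for some
`ϑ ∈ {R, E_0, E_1, E_2}`. -/
def IsPseudopal (w : Word) : Prop := ∃ t : AM, t.apply w = w

/-- `v` is an image of `w` if `v = ϑ(w)` for some `ϑ ∈ {R, E_0, E_1, E_2}`. -/
def IsImage (w v : Word) : Prop := ∃ t : AM, v = t.apply w

/-- `v` is the `ϑ`-palindromic closure of `u`: the shortest `ϑ`-palindrome
having `u` as a prefix. -/
def IsPalClosure (t : AM) (u v : Word) : Prop :=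
  u <+: v ∧ t.apply v = v ∧
    ∀ v' : Word, u <+: v' → t.apply v' = v' → v.length ≤ v'.length

/-- `w` is the sequence of prefixes associated with the directive bi-sequence
`(Δ, Θ)`: `w 0 = ε` and `w (n+1) = (w n · δ_{n+1})^{ϑ_{n+1}}`. -/
def DirectivePrefixes (Δ : ℕ → Letter) (Θ : ℕ → AM) (w : ℕ → Word) : Prop :=
  w 0 = [] ∧ ∀ n : ℕ, IsPalClosure (Θ (n + 1)) (w n ++ [Δ (n + 1)]) (w (n + 1))

/-- A pseudopalindromic prefix `v` of `w_{n+1}` is missed between `w_n` and `w_{n+1}`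
if `|w_n| < |v| < |w_{n+1}|`. -/
def MissedBetween (wn wn1 v : Word) : Prop :=
  v <+: wn1 ∧ IsPseudopal v ∧ wn.length < v.length ∧ v.length < wn1.length

/-- An image of `u` occurs in `v` at (0-indexed) position `p`. -/
def OccursImageAt (u v : Word) (p : ℕ) : Prop :=
  p + u.length ≤ v.length ∧ IsImage u ((v.drop p).take u.length)

/-- Assumption A for the pair `(wn, wn1)`: some image of `wn` occurs in `wn1`
at a position `p` with `0 < p < |wn1| - |wn|`, overlapping both the prefix
occurrence of `wn` and the suffix occurrence of an image of `wn`. -/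
def AssumptionA (wn wn1 : Word) : Prop :=
  ∃ p : ℕ, 0 < p ∧ p < wn1.length - wn.length ∧ p < wn.length ∧
    wn1.length - wn.length < p + wn.length ∧ OccursImageAt wn wn1 p

/-- The prefix of length `n` of the directive bi-sequence is normalized:
every pseudopalindromic prefix of `w n` equals `w k` for some `k ≤ n`. -/
def NormalizedUpTo (w : ℕ → Word) (n : ℕ) : Prop :=
  ∀ v : Word, v <+: w n → IsPseudopal v → ∃ k : ℕ, k ≤ n ∧ v = w k

/-- `rep u l` is the `l`-fold concatenation `u^l`. -/
def rep (u : Word) (l : ℕ) : Word := (List.replicate l u).flatten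

/-- `rmSuf x y` is `x · y⁻¹`: the word `x` with its suffix of length `|y|` removed. -/
def rmSuf (x y : Word) : Word := x.take (x.length - y.length)

/-- `v` is a prefix of the infinite periodic word `pat^ω`. -/
def IsPrefixOfPow (pat v : Word) : Prop :=
  ∀ q : ℕ, ∀ hq : q < v.length, ∃ hp : q % pat.length < pat.length,
    v.get ⟨q, hq⟩ = pat.get ⟨q % pat.length, hp⟩

namespace AM

theorem letter_letter (t : AM) (a : Letter) : t.letter (t.letter a) = a := by
  cases t <;> simp [letter]

theorem letter_comp_letter (t : AM) : t.letter ∘ t.letter = id :=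
  funext t.letter_letter

@[simp]
theorem length_apply (t : AM) (u : Word) : (t.apply u).length = u.length := by
  simp [apply]

@[simp]
theorem apply_apply (t : AM) (u : Word) : t.apply (t.apply u) = u := by
  simp [apply, letter_comp_letter]

theorem apply_append (t : AM) (u v : Word) : t.apply (u ++ v) = t.apply v ++ t.apply u := by
  simp [apply]

theorem apply_take (t : AM) (u : Word) (k : ℕ) :
    t.apply (u.take k) = (t.apply u).drop (u.length - k) := by
  rw [apply, apply, List.drop_reverse, List.length_map, List.map_take]
  obtain h | h := le_total k u.length
  · rw [Nat.sub_sub_self h]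
  · simp [Nat.sub_eq_zero_of_le h, List.take_of_length_le, h]

theorem apply_drop (t : AM) (u : Word) (k : ℕ) :
    t.apply (u.drop k) = (t.apply u).take (u.length - k) := by
  rw [apply, apply, List.take_reverse, List.length_map, List.map_drop]
  obtain h | h := le_total k u.length
  · rw [Nat.sub_sub_self h]
  · simp [Nat.sub_eq_zero_of_le h, List.drop_of_length_le, h]

/-- The product of three letter involutions is one of the four letter involutions,
unless it is a cyclic permutation of the three letters. -/
theorem exists_letter_eq_comp_or_ne (a b c : AM) :
    (∃ t : AM, ∀ x, t.letter x = a.letter (b.letter (c.letter x))) ∨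
      ∀ x, a.letter (b.letter (c.letter (a.letter (b.letter (c.letter x))))) ≠ x := by
  rcases a with _ | i <;> rcases b with _ | j <;> rcases c with _ | k
  · exact .inl ⟨R, fun x => rfl⟩
  · exact .inl ⟨E k, fun x => rfl⟩
  · exact .inl ⟨E j, fun x => rfl⟩
  · by_cases h : j = k
    · exact .inl ⟨R, fun x => by subst h; exact (letter_letter (E j) x).symm⟩
    · right; revert j k; simp only [letter]; decide
  · exact .inl ⟨E i, fun x => rfl⟩
  · by_cases h : i = k
    · exact .inl ⟨R, fun x => by subst h; exact (letter_letter (E i) x).symm⟩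
    · right; revert i k; simp only [letter]; decide
  · by_cases h : i = j
    · exact .inl ⟨R, fun x => by subst h; exact (letter_letter (E i) x).symm⟩
    · right; revert i j; simp only [letter]; decide
  · exact .inl ⟨E (i - j + k), fun x => by revert i j k x; simp only [letter]; decide⟩

end AM

/-- A nonempty word whose reversal is its letterwise image under a product of three
letter involutions is a pseudopalindrome. -/
theorem isPseudopal_of_reverse_eq_map {a b c : AM} {y : Word} (hy : y ≠ [])
    (h : y.reverse = y.map fun x => a.letter (b.letter (c.letter x))) : IsPseudopal y := by
  rcases AM.exists_letter_eq_comp_or_ne a b c with ⟨t, ht⟩ | hne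
  · refine ⟨t, ?_⟩
    rw [AM.apply, funext ht, ← h, List.reverse_reverse]
  · exfalso
    obtain ⟨x, hx⟩ := List.exists_mem_of_ne_nil y hy
    have h2 : y.map (fun x => a.letter (b.letter (c.letter
        (a.letter (b.letter (c.letter x)))))) = y.map id := by
      have := congrArg (List.map fun x => a.letter (b.letter (c.letter x))) h
      rw [List.map_reverse, ← h, List.reverse_reverse, h, List.map_map] at this
      simpa [Function.comp_def] using this.symm
    exact hne x (List.map_inj_left.1 h2 x hx)

/-- If a letterwise image of a pseudopalindrome `u` under a product of two letter involutions
overlaps `u`, then the prefix of `u` as long as the overlap is a pseudopalindrome. -/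
theorem isPseudopal_take_of_overlap {t a b : AM} {u v : Word} {p : ℕ} (hu : t.apply u = u)
    (huv : u <+: v) (hp : p < u.length)
    (h : (v.drop p).take u.length = u.map fun x => a.letter (b.letter x)) :
    IsPseudopal (u.take (u.length - p)) := by
  obtain ⟨s, rfl⟩ := huv
  have hmap : u.drop p = (u.take (u.length - p)).map fun x => a.letter (b.letter x) := by
    have := congrArg (List.take (u.length - p)) h
    rw [List.take_take, min_eq_left (Nat.sub_le _ _), ← List.map_take,
      List.drop_append_of_le_length hp.le, List.take_left' (by simp)] at this
    exact this
  have hrev : u.drop p = t.apply (u.take (u.length - p)) := by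
    conv_lhs => rw [← hu]
    rw [AM.apply, AM.apply, List.drop_reverse, List.length_map, List.map_take]
  refine isPseudopal_of_reverse_eq_map (a := t) (b := a) (c := b) ?_ ?_
  · rw [ne_eq, ← List.length_eq_zero_iff, List.length_take]
    omega
  · have := congrArg (List.map t.letter) (hrev.symm.trans hmap)
    generalize u.take (u.length - p) = y at this ⊢
    simpa [AM.apply, Function.comp_def, AM.letter_letter] using this

namespace IsPalClosure

variable {t : AM} {u W : Word} {d : Letter}

theorem length_lt (h : IsPalClosure t (u ++ [d]) W) : u.length < W.length := by
  have := h.1.length_le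
  simp at this
  omega

theorem length_le (h : IsPalClosure t (u ++ [d]) W) : W.length ≤ 2 * u.length + 2 := by
  have := h.2.2 ((u ++ [d]) ++ t.apply (u ++ [d])) (List.prefix_append _ _)
    (by rw [AM.apply_append, AM.apply_apply])
  simp at this
  omega

theorem length_le_of_letter_eq (h : IsPalClosure t (u ++ [d]) W) (hd : t.letter d = d) :
    W.length ≤ 2 * u.length + 1 := by
  have := h.2.2 ((u ++ [d]) ++ t.apply u) (List.prefix_append _ _)
    (by rw [AM.apply_append, AM.apply_apply, AM.apply_append]; simp [AM.apply, hd])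
  simp at this
  omega

theorem eq_append_of_length_eq (h : IsPalClosure t (u ++ [d]) W)
    (hW : W.length = 2 * u.length + 2) : W = u ++ [d, t.letter d] ++ t.apply u := by
  obtain ⟨⟨r, rfl⟩, hpal, -⟩ := h
  rw [AM.apply_append] at hpal
  have hr : t.apply r = u ++ [d] := List.append_inj_left hpal (by simp at hW ⊢; omega)
  rw [← AM.apply_apply t r, hr, AM.apply_append]
  simp [AM.apply]

end IsPalClosure

/-- A factor of a `t`-palindrome, reflected. -/
theorem take_drop_reflect {t : AM} {W : Word} (hW : t.apply W = W) {p N : ℕ}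
    (hp : p + N ≤ W.length) :
    (W.drop (W.length - N - p)).take N = t.apply ((W.drop p).take N) := by
  rw [AM.apply_take, AM.apply_drop, hW, List.length_drop, List.drop_take]
  congr 2 <;> omega

/-- Proposition (one missed prefix, even case with distinct middle letters): with
a normalized prefix of length `n`, Assumption A and exactly one missed
pseudopalindromic prefix, if `w n = w_{n-1}·c₁c₂·ϑ(w_{n-1})` with `c₁ ≠ c₂` then
`w (n+1) = w_n·d₁d₂·ϑ'(w_n)` for some distinct letters `d₁ ≠ d₂` and some `ϑ'`. -/
theorem even_form_propagates
    (Δ : ℕ → Letter) (Θ : ℕ → AM) (w : ℕ → Word)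
    (hw : DirectivePrefixes Δ Θ w) (n : ℕ) (hn : 1 ≤ n)
    (hnorm : NormalizedUpTo w n)
    (hA : AssumptionA (w n) (w (n + 1)))
    (v : Word) (hv : MissedBetween (w n) (w (n + 1)) v)
    (huniq : ∀ v' : Word, MissedBetween (w n) (w (n + 1)) v' → v' = v)
    (hshape : ∃ (c₁ c₂ : Letter) (t : AM), c₁ ≠ c₂ ∧
      w n = w (n - 1) ++ [c₁, c₂] ++ t.apply (w (n - 1))) :
    ∃ (d₁ d₂ : Letter) (t' : AM), d₁ ≠ d₂ ∧
      w (n + 1) = w n ++ [d₁, d₂] ++ t'.apply (w n) := by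
  have hcl := hw.2 n
  have hpre : w n <+: w (n + 1) := (List.prefix_append _ _).trans hcl.1
  have hpal : (Θ n).apply (w n) = w n := by
    obtain ⟨m, rfl⟩ := Nat.exists_eq_add_of_le' hn
    exact (hw.2 m).2.1
  have hmono : StrictMono fun k => (w k).length :=
    strictMono_nat_of_lt_succ fun k => (hw.2 k).length_lt
  have hlen : (w n).length = 2 * (w (n - 1)).length + 2 := by
    obtain ⟨c₁, c₂, t, -, h⟩ := hshape
    rw [h]
    simp
    omega
  have hoverlap : ∀ (q : ℕ) (a b : AM), 0 < q → q < (w n).length →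
      ((w (n + 1)).drop q).take (w n).length = (w n).map (fun x => a.letter (b.letter x)) →
      (w (n - 1)).length + 2 ≤ q := by
    intro q a b hq0 hq h
    obtain ⟨k, hk, hkeq⟩ := hnorm _ (List.take_prefix _ _)
      (isPseudopal_take_of_overlap hpal hpre hq h)
    have hkl := congrArg List.length hkeq
    rw [List.length_take] at hkl
    have hkn : k ≠ n := by
      rintro rfl
      omega
    have : (w k).length ≤ (w (n - 1)).length := hmono.monotone (by omega)
    omega
  obtain ⟨p, hp0, hp1, hp2, hp3, hp4, τ, hτ⟩ := hA
  have h1 := hoverlap p τ (Θ n) hp0 hp2 (by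
    rw [hτ]
    conv_lhs => rw [← hpal]
    simp [AM.apply, Function.comp_def])
  have h2 := hoverlap ((w (n + 1)).length - (w n).length - p) (Θ (n + 1)) τ
    (by omega) (by omega) (by
      rw [take_drop_reflect hcl.2.1 hp4, hτ]
      simp [AM.apply, Function.comp_def])
  have h3 := hcl.length_le
  refine ⟨Δ (n + 1), (Θ (n + 1)).letter (Δ (n + 1)), Θ (n + 1), fun hd => ?_,
    hcl.eq_append_of_length_eq (by omega)⟩
  have := hcl.length_le_of_letter_eq hd.symm
  omega
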